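/- arXiv:1908.04966 — 11 statements merged into one kernel-verified Lean document; each statement's English description precedes it below -/
import Mathlib

section
/- Let Q be a finite nonempty quasigroup, i.e., a finite nonempty type with a multiplication · such that for every a the maps x ↦ a·x and x ↦ x·a are bijections, which is idempotent (x·x = x), semisymmetric (y·(x·y) = x), and left self-distributive (x·(y·z) = (x·y)·(x·z)), and suppose the cardinality of Q is coprime to 3. Then there exist a finite index set I and for each i ∈ I a magma Q_i which is either (ZMod (p^t), x·y = a·x + (1−a)·y) for some prime p with p ≡ 1 (mod 3), some t ≥ 1, and some a ∈ ZMod (p^t) with a² − a + 1 = 0, or ((ZMod (q^u))², v·w = v·T + w·(1−T)) for some prime q with q ≡ 2 (mod 3) and some u ≥ 1, where T is the 2×2 matrix with rows (0, −1) and (1, 1), such that Q is isomorphic as a magma (via a multiplication-preserving bijection) to the product magma ∏_{i ∈ I} Q_i. -/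
namespace DNR
section
variable {Q : Type} [Mul Q]

structure MQ (Q : Type) [Mul Q] : Prop where
  idem : ∀ x : Q, x * x = x
  semi : ∀ x y : Q, y * (x * y) = x
  semi' : ∀ x y : Q, (y * x) * y = x
  ld : ∀ x y z : Q, x * (y * z) = (x * y) * (x * z)

namespace MQ
variable (h : MQ Q)
include h

theorem rd (x y z : Q) : (y * z) * x = (y * x) * (z * x) := by
  have h1 := h.ld x (y * x) (z * x)
  rw [h.semi, h.semi] at h1
  have := h.semi' ((y * x) * (z * x)) x
  rw [h1] at this
  exact this

theorem lc {x y z : Q} (e : x * y = x * z) : y = z := by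
  rw [← h.semi' y x, e, h.semi']

theorem rc {x y z : Q} (e : y * x = z * x) : y = z := by
  rw [← h.semi y x, e, h.semi]

theorem id1 (x y : Q) : x * (y * (y * x)) = (x * y) * y := by
  rw [h.ld, h.ld x y x, h.idem, h.semi']

theorem cube (x y : Q) : y * (y * (y * x)) = ((x * y) * y) * y := by
  -- both are (xy)(yx)
  have e1 : y * (y * (y * x)) = (x * y) * (y * x) := by
    have hp : y * (y * x) = ((x * y) * y) * x := by
      rw [← h.id1, h.semi']
    rw [hp, h.ld, h.semi]
  have e2 : ((x * y) * y) * y = (x * y) * (y * x) := by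
    rw [← h.id1 x y, h.rd, h.semi' (y * x) y]
  rw [e1, e2]

/-- Left translation as a permutation. -/
def L (x : Q) : Equiv.Perm Q where
  toFun y := x * y
  invFun y := y * x
  left_inv y := h.semi' y x
  right_inv y := h.semi y x

theorem L_apply (x y : Q) : h.L x y = x * y := rfl
theorem L_inv_apply (x y : Q) : (h.L x)⁻¹ y = y * x := rfl

theorem L_mul (x y : Q) : h.L (x * y) = h.L x * h.L y * (h.L x)⁻¹ := by
  rw [eq_mul_inv_iff_mul_eq]
  ext z
  simp only [Equiv.Perm.mul_apply, L_apply]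
  exact (h.ld x y z).symm

theorem L_mul' (x y : Q) : h.L (x * y) = (h.L y)⁻¹ * h.L x * h.L y := by
  rw [mul_assoc, eq_inv_mul_iff_mul_eq]
  ext z
  simp only [Equiv.Perm.mul_apply, L_apply]
  rw [h.ld, h.semi]

theorem braid (x y : Q) : h.L x * h.L y * h.L x = h.L y * h.L x * h.L y := by
  have e := (h.L_mul x y).symm.trans (h.L_mul' x y)
  rw [mul_inv_eq_iff_eq_mul] at e
  have := congrArg (fun t => h.L y * t) e
  simp only [← mul_assoc, mul_inv_cancel, one_mul] at this
  rw [← this]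

theorem L6 (x : Q) : h.L x ^ 6 = 1 := by
  have : h.L x ^ 3 = (h.L x)⁻¹ ^ 3 := by
    ext z
    simp only [pow_succ, pow_zero, one_mul, Equiv.Perm.mul_apply, L_apply, L_inv_apply]
    exact h.cube z x
  calc h.L x ^ 6 = h.L x ^ 3 * h.L x ^ 3 := by rw [← pow_add]
    _ = 1 := by nth_rw 1 [this]; rw [inv_pow, inv_mul_cancel]

/-- The square of the "half twist". -/
def D (e x : Q) : Equiv.Perm Q := (h.L e * h.L x * h.L e) * (h.L e * h.L x * h.L e)

theorem D_mul (e x p q : Q) : h.D e x (p * q) = h.D e x p * h.D e x q := by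
  have hL : ∀ z p q, h.L z (p * q) = h.L z p * h.L z q := fun z p q => h.ld z p q
  simp only [D, Equiv.Perm.mul_apply, hL]

theorem D_comm_e (e x : Q) : h.D e x * h.L e = h.L e * h.D e x := by
  have b := h.braid e x
  have b1 : (h.L e * h.L x * h.L e) * h.L e = h.L x * (h.L e * h.L x * h.L e) := by
    rw [b]; simp only [mul_assoc] at b ⊢; rw [b]
  have b2 : (h.L e * h.L x * h.L e) * h.L x = h.L e * (h.L e * h.L x * h.L e) := by
    simp only [mul_assoc] at b ⊢; rw [b]
  rw [D, mul_assoc, b1, ← mul_assoc, b2, mul_assoc]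

theorem D_e (e x : Q) : h.D e x e = e := by
  simp only [D, Equiv.Perm.mul_apply, L_apply, h.idem, h.semi]

theorem D_x (e x : Q) : h.D e x x = x := by
  simp only [D, Equiv.Perm.mul_apply, L_apply, h.idem, h.semi]

theorem D_shift (e x : Q) : h.D e (e * x) = h.D e x := by
  have := h.D_comm_e e x
  have e1 : h.D e (e * x) = h.L e * h.D e x * (h.L e)⁻¹ := by
    simp only [D, L_mul]; group
  rw [e1, ← this]; group

theorem lemA (e u v : Q) : h.D e u ((e * (e * v)) * ((u * e) * e)) = u * v := by
  have hc := h.D_comm_e e u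
  have b := h.braid e u
  have h6 := h.L6 e
  have e1 : (e * (e * v)) * ((u * e) * e) =
      ((h.L ((u * e) * e))⁻¹ * (h.L e * h.L e)) v := rfl
  have key : h.D e u * ((h.L ((u * e) * e))⁻¹ * (h.L e * h.L e)) = h.L u := by
    rw [L_mul', L_mul']
    generalize hd : h.D e u = d at *
    unfold D at hd
    generalize h.L e = a at *
    generalize h.L u = x at *
    have hc' : d * a⁻¹ = a⁻¹ * d := by
      rw [eq_inv_mul_iff_mul_eq, ← mul_assoc, ← hc]; group
    have h1 : d * x⁻¹ = a * x * a * x * a := by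
      rw [mul_inv_eq_iff_eq_mul, ← hd]
      simp only [mul_assoc] at b ⊢
      rw [b]
    have h6' : a * a * a * a * a * a = 1 := by rw [← h6]; simp only [pow_succ, pow_zero, one_mul]
    calc d * ((a⁻¹ * (a⁻¹ * x * a) * a)⁻¹ * (a * a))
        = (d * a⁻¹) * a⁻¹ * x⁻¹ * a * a * a * a := by simp [mul_assoc]
      _ = (a⁻¹ * d) * a⁻¹ * x⁻¹ * a * a * a * a := by rw [hc']
      _ = a⁻¹ * (d * a⁻¹) * x⁻¹ * a * a * a * a := by simp only [mul_assoc]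
      _ = a⁻¹ * (a⁻¹ * d) * x⁻¹ * a * a * a * a := by rw [hc']
      _ = a⁻¹ * a⁻¹ * (d * x⁻¹) * a * a * a * a := by simp only [mul_assoc]
      _ = a⁻¹ * (x * a * x) * a * a * a * a * a := by rw [h1]; simp [mul_assoc]
      _ = x * (a * a * a * a * a * a) := by rw [← b]; simp [mul_assoc]
      _ = x := by rw [h6', mul_one]
  rw [e1, ← Equiv.Perm.mul_apply, key, L_apply]

theorem psi_fix (e u v : Q) : h.D e u (h.D e v (u * v)) = u * v := by
  have h1 := h.lemA e (e * (e * v)) ((u * e) * e)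
  have : e * (e * (u * e * e)) * (e * (e * v) * e * e) = u * v := by
    simp only [h.semi, h.semi']
  rw [this, D_shift, D_shift] at h1
  rw [h1, lemA]

theorem D_one (e v u : Q) : h.D e v u = u := by
  have h1 := h.psi_fix e u v
  have h2 := h.psi_fix e u (e * v)
  rw [D_shift, h.ld, D_mul, D_mul, h1] at h2
  have h3 := h.rc h2
  simp only [D_mul, D_e] at h3
  have h4 := h.rc h3
  apply (h.D e u).injective
  rw [h4, D_x]

theorem swap (e u v : Q) : (e * (e * v)) * ((u * e) * e) = u * v := by
  have := h.lemA e u v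
  rwa [D_one] at this

/-! loop -/
theorem add_comm' (e x y : Q) : (e * x) * (y * e) = (e * y) * (x * e) := by
  have := h.swap e (e * x) (y * e)
  simp only [h.semi, h.semi'] at this
  exact this.symm


/-- Loop translation. -/
def lam (e x : Q) : Equiv.Perm Q := h.L (e * x) * (h.L e)⁻¹

theorem lam_apply (e x y : Q) : h.lam e x y = (e * x) * (y * e) := rfl

theorem lam_comm (e x y : Q) : h.lam e x y = h.lam e y x := by
  rw [lam_apply, lam_apply, h.add_comm']

theorem lam_e (e x : Q) : h.lam e x e = x := by
  rw [lam_apply, h.idem, h.semi']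

theorem lam_zero (e : Q) : h.lam e e = 1 := by
  ext y
  rw [lam_comm, lam_e]; rfl

theorem F1 (e x : Q) : h.lam e (x * e) * h.lam e (e * x) = h.lam e x := by
  ext y
  simp only [Equiv.Perm.mul_apply, lam_apply]
  rw [h.semi, h.rd e (e * (e * x)), h.semi', h.ld x, h.semi]
  rw [h.ld, h.semi]

theorem F1' (e x : Q) : h.lam e (e * x) * h.lam e (x * e) = h.lam e x := by
  ext y
  simp only [Equiv.Perm.mul_apply]
  rw [h.lam_comm e (x * e), h.lam_comm e (e * x), h.lam_comm e x]
  simp only [lam_apply]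
  rw [h.semi' x e, h.ld e (e * y), h.semi, h.rd x, h.semi', h.rd e, h.semi']

theorem F3 (e x : Q) : h.lam e (((x * e) * e) * e) * h.lam e x = 1 := by
  ext y
  simp only [Equiv.Perm.mul_apply]
  rw [h.lam_comm e (x * e * e * e), ← h.cube]
  simp only [lam_apply]
  rw [h.semi' (e * (e * x)) e, h.ld e (e * x), h.semi, h.semi']; rfl

theorem F3' (e x : Q) : h.lam e x * h.lam e (((x * e) * e) * e) = 1 := by
  have := h.F3 e x
  exact mul_eq_one_comm.mp this

theorem T (e x y z : Q) : h.lam e x (h.lam e y z) =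
    h.lam e (h.lam e (x * e) y) (h.lam e (e * x) z) := by
  simp only [lam_apply]
  rw [h.rd e (e * y), h.semi', h.semi, h.rd e (e * (e * x)), h.semi', h.ld (e * x) y,
    h.ld e x, h.semi]

theorem T' (e x y z : Q) : h.lam e x (h.lam e y z) =
    h.lam e (h.lam e (e * x) y) (h.lam e (x * e) z) := by
  rw [h.lam_comm e y z, T, lam_comm]

theorem L_lam (e x y : Q) : h.lam e (h.lam e x y) =
    h.lam e (e * x) * h.lam e y * h.lam e (x * e) := by
  have h1 := fun z => h.T' e (x * e) y z
  have h2 : h.lam e (x * e) * h.lam e y = h.lam e (h.lam e x y) * h.lam e ((x * e) * e) := by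
    ext z
    have := h1 z
    rw [h.semi] at this
    exact this
  have h3 := h.F3 e (e * x)
  rw [h.semi'] at h3
  have h4 : h.lam e (x * e) * h.lam e y * h.lam e (e * x) = h.lam e (h.lam e x y) := by
    rw [h2, mul_assoc, h3, mul_one]
  have h5 := fun z => h.T e (e * x) y z
  have h6 : h.lam e (e * x) * h.lam e y = h.lam e (h.lam e x y) * h.lam e (e * (e * x)) := by
    ext z
    have := h5 z
    rw [h.semi'] at this
    exact this
  have h7 := h.F3' e (e * (e * x))
  rw [h.semi', h.semi'] at h7
  rw [h6, mul_assoc, h7, mul_one]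

theorem comm_adj (e x : Q) : Commute (h.lam e (e * x)) (h.lam e (x * e)) :=
  (h.F1' e x).trans (h.F1 e x).symm

theorem comm_l (e x : Q) : Commute (h.lam e (e * x)) (h.lam e x) := by
  rw [← h.F1 e x]
  exact (h.comm_adj e x).mul_right (Commute.refl _)

theorem comm_r (e x : Q) : Commute (h.lam e x) (h.lam e (x * e)) := by
  rw [← h.F1 e x]
  exact (Commute.refl _).mul_left (h.comm_adj e x)

theorem central1 (e x y : Q) : Commute (h.lam e (e * x) * h.lam e x) (h.lam e y) := by
  have a1 : h.lam e x * h.lam e y * h.lam e ((x * e) * e) =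
      h.lam e ((x * e) * e) * h.lam e y * h.lam e x := by
    ext z
    simp only [Equiv.Perm.mul_apply]
    rw [h.T e x y, h.T' e ((x * e) * e) y, h.semi]
    have h3 := h.F3' e (e * x)
    rw [h.semi'] at h3
    have h4 := h.F3 e x
    rw [← Equiv.Perm.mul_apply (h.lam e (e * x)), h3, ← Equiv.Perm.mul_apply _ (h.lam e x), h4]
  have h3 := h.F3 e (e * x)
  rw [h.semi'] at h3
  have h4 : h.lam e ((x * e) * e) = (h.lam e (e * x))⁻¹ := eq_inv_of_mul_eq_one_left h3
  rw [h4] at a1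
  have hc := h.comm_l e x
  generalize h.lam e (e * x) = p at *
  generalize h.lam e x = q at *
  generalize h.lam e y = r at *
  rw [mul_inv_eq_iff_eq_mul] at a1
  show p * q * r = r * (p * q)
  rw [mul_assoc, a1, hc.eq]
  simp [mul_assoc]

theorem cube_central (e x y : Q) : Commute (h.lam e x ^ 3) (h.lam e y) := by
  have h1 := h.central1 e x y
  have h2 := h.central1 e (x * e) y
  rw [h.semi] at h2
  have h3 := h1.mul_left h2
  have h4 : h.lam e (e * x) * h.lam e x * (h.lam e x * h.lam e (x * e)) = h.lam e x ^ 3 := by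
    have c1 := (h.comm_r e x).eq
    rw [c1, ← mul_assoc, mul_assoc (h.lam e (e * x)), c1, ← mul_assoc, F1']
    rw [pow_succ, pow_two]
  rwa [h4] at h3

theorem lam_pow (e x : Q) (k : ℕ) : h.lam e ((h.lam e x ^ k) e) = h.lam e x ^ k := by
  induction k with
  | zero => simpa using h.lam_zero e
  | succ k ih =>
    rw [pow_succ', Equiv.Perm.mul_apply, L_lam, ih,
      mul_assoc, ((h.comm_r e x).pow_left k).eq, ← mul_assoc, F1']

theorem free (e x : Q) (k : ℕ) (p : Q) (hp : (h.lam e x ^ k) p = p) : h.lam e x ^ k = 1 := by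
  rw [← lam_pow] at hp
  have : (h.lam e x ^ k) e = e := by
    rw [h.lam_comm] at hp
    exact (h.lam e p).injective (hp.trans (h.lam_e e p).symm)
  rw [← lam_pow, this, lam_zero]

theorem lam_commute [Fintype Q] (hcop : Nat.Coprime (Fintype.card Q) 3) (e x y : Q) :
    Commute (h.lam e x) (h.lam e y) := by
  classical
  have ho : Nat.Coprime 3 (orderOf (h.lam e x)) := by
    rw [Nat.Prime.coprime_iff_not_dvd Nat.prime_three]
    rintro ⟨m, hm⟩
    have hpos : 0 < orderOf (h.lam e x) := orderOf_pos _
    have hz : h.lam e x ^ m ≠ 1 := pow_ne_one_of_lt_orderOf (by omega) (by omega)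
    have hz3 : (h.lam e x ^ m) ^ 3 = 1 := by
      rw [← pow_mul, mul_comm, ← hm, pow_orderOf_eq_one]
    have hfix : ∀ p, (h.lam e x ^ m) p ≠ p := fun p hp => hz (h.free e x m p hp)
    generalize h.lam e x ^ m = z at *
    have : Fact (Nat.Prime 3) := ⟨Nat.prime_three⟩
    have h1 := Equiv.Perm.card_fixedPoints_modEq (α := Q) (f := (z : Q → Q)) (p := 3) (n := 1) (by
      funext p
      exact congrArg (fun s : Equiv.Perm Q => s p) hz3)
    have h2 : Fintype.card (Function.fixedPoints (z : Q → Q)) = 0 := by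
      rw [Fintype.card_eq_zero_iff]
      exact ⟨fun p => hfix p.1 p.2⟩
    have h3 : Fintype.card Q ≡ 0 [MOD 3] := by
      rw [← h2]; exact h1
    rw [Nat.modEq_zero_iff_dvd] at h3
    have := Nat.dvd_gcd h3 (dvd_refl 3)
    rw [hcop] at this
    omega
  obtain ⟨m, hm⟩ := exists_pow_eq_self_of_coprime ho
  rw [← hm]
  exact (h.cube_central e x y).pow_left m

/-- The abelian group. -/
@[reducible] def grp [Fintype Q] (hcop : Nat.Coprime (Fintype.card Q) 3) (e : Q) :
    AddCommGroup Q :=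
  letI : Add Q := ⟨fun x y => h.lam e x y⟩
  letI : Zero Q := ⟨e⟩
  letI : Neg Q := ⟨fun x => ((x * e) * e) * e⟩
  { AddGroup.ofLeftAxioms (G := Q) (fun x y z => by
      show h.lam e (h.lam e x y) z = h.lam e x (h.lam e y z)
      rw [h.lam_comm e _ z, h.lam_comm e y z]
      exact congrArg (fun s : Equiv.Perm Q => s y) (h.lam_commute hcop e z x).eq)
    (fun x => by
      show h.lam e e x = x
      rw [lam_zero]; rfl)
    (fun x => by
      show h.lam e (((x * e) * e) * e) x = e
      have := congrArg (fun s : Equiv.Perm Q => s e) (h.F3 e x)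
      simpa [lam_e] using this) with
    add_comm := fun x y => h.lam_comm e x y }

end MQ

theorem affine {Q : Type} [Fintype Q] [Nonempty Q] [Mul Q] (h : MQ Q)
    (hcop : Nat.Coprime (Fintype.card Q) 3) :
    ∃ (_ : AddCommGroup Q) (al : Q →+ Q), (∀ x, al (al x) = al x - x) ∧
      ∀ x y, x * y = al x + (y - al y) := by
  obtain ⟨e⟩ := ‹Nonempty Q›
  let _ := h.grp hcop e
  have hadd : ∀ x y : Q, x + y = (e * x) * (y * e) := fun x y => rfl
  refine ⟨h.grp hcop e, ⟨⟨fun x => x * e, ?_⟩, ?_⟩, ?_, ?_⟩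
  · exact h.idem e
  · intro x y
    simp only
    rw [hadd, hadd, h.rd, h.semi', h.semi]
  · intro x
    simp only [AddMonoidHom.coe_mk, ZeroHom.coe_mk]
    rw [eq_sub_iff_add_eq, hadd, h.semi, ← h.rd, h.idem]
  · intro x y
    simp only [AddMonoidHom.coe_mk, ZeroHom.coe_mk]
    have : y - y * e = e * y := by
      rw [sub_eq_iff_eq_add, add_comm, hadd, h.semi, h.semi', h.idem]
    rw [this, hadd, h.semi, h.semi']
end
end DNR

namespace DNR

abbrev E := QuadraticAlgebra ℤ (-1) 1
abbrev om : E := QuadraticAlgebra.omega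

theorem norm_eq (z : E) : z.norm = z.re ^ 2 + z.re * z.im + z.im ^ 2 := by
  rw [QuadraticAlgebra.norm_def]; ring

theorem norm_nonneg (z : E) : 0 ≤ z.norm := by
  rw [norm_eq]; nlinarith [sq_nonneg (2 * z.re + z.im), sq_nonneg z.im]

theorem norm_eq_zero {z : E} (h : z.norm = 0) : z = 0 := by
  rw [norm_eq] at h
  have h1 : z.im ^ 2 = 0 := by
    nlinarith [sq_nonneg (2 * z.re + z.im), sq_nonneg z.im]
  have h2 : z.im = 0 := by simpa using h1
  have h3 : z.re = 0 := by rw [h2] at h; simpa using h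
  ext <;> simp [h2, h3]

instance : NoZeroDivisors E where
  eq_zero_or_eq_zero_of_mul_eq_zero {a b} h := by
    have h1 := congrArg QuadraticAlgebra.norm h
    rw [map_mul, QuadraticAlgebra.norm_zero, mul_eq_zero] at h1
    exact h1.imp norm_eq_zero norm_eq_zero

instance : IsDomain E := NoZeroDivisors.to_isDomain _

theorem round (A n : ℤ) (hn : 0 < n) : ∃ q, -n ≤ 2 * (A - n * q) ∧ 2 * (A - n * q) ≤ n := by
  refine ⟨(2 * A + n) / (2 * n), ?_⟩
  have h1 := Int.emod_add_mul_ediv (2 * A + n) (2 * n)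
  have h2 := Int.emod_nonneg (2 * A + n) (b := 2 * n) (by omega)
  have h3 := Int.emod_lt_of_pos (2 * A + n) (b := 2 * n) (by omega)
  generalize (2 * A + n) / (2 * n) = q at *
  constructor <;> nlinarith

theorem division (x g : E) (hg : g ≠ 0) : ∃ q : E, (x - q * g).norm < g.norm := by
  have hn : 0 < g.norm := lt_of_le_of_ne (norm_nonneg g) fun h => hg (norm_eq_zero h.symm)
  obtain ⟨q1, a1, a2⟩ := round (x * star g).re g.norm hn
  obtain ⟨q2, b1, b2⟩ := round (x * star g).im g.norm hn
  refine ⟨⟨q1, q2⟩, ?_⟩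
  have e1 : (x - ⟨q1, q2⟩ * g) * star g =
      ⟨(x * star g).re - g.norm * q1, (x * star g).im - g.norm * q2⟩ := by
    rw [sub_mul, mul_assoc, ← QuadraticAlgebra.algebraMap_norm_eq_mul_star]
    ext <;> simp <;> ring
  have e2 := congrArg QuadraticAlgebra.norm e1
  rw [map_mul, QuadraticAlgebra.norm_star, norm_eq ⟨(x * star g).re - g.norm * q1, (x * star g).im - g.norm * q2⟩] at e2
  simp only at e2
  generalize (x * star g).re - g.norm * q1 = r at *
  generalize (x * star g).im - g.norm * q2 = s at *
  generalize g.norm = n at *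
  have h1 : r ^ 2 * 4 ≤ n ^ 2 := by nlinarith
  have h2 : s ^ 2 * 4 ≤ n ^ 2 := by nlinarith
  have h3 : (r ^ 2 + r * s + s ^ 2) < n ^ 2 := by nlinarith [sq_nonneg (r - s)]
  by_contra hcon
  push Not at hcon
  have h4 := mul_le_mul_of_nonneg_right hcon hn.le
  nlinarith

instance : IsPrincipalIdealRing E where
  principal I := by
    by_cases hI : I = ⊥
    · exact hI ▸ bot_isPrincipal
    obtain ⟨z, hz, hz0⟩ := Submodule.exists_mem_ne_zero_of_ne_bot hI
    have hex : ∃ k : ℕ, ∃ g ∈ I, g ≠ 0 ∧ g.norm.toNat = k := ⟨_, z, hz, hz0, rfl⟩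
    classical
    obtain ⟨g, hg, hg0, hk⟩ := Nat.find_spec hex
    refine ⟨g, le_antisymm ?_ ?_⟩
    · intro x hx
      obtain ⟨q, hq⟩ := division x g hg0
      have hmem : x - q * g ∈ I := I.sub_mem hx (I.mul_mem_left q hg)
      by_cases h0 : x - q * g = 0
      · exact Submodule.mem_span_singleton.mpr ⟨q, (sub_eq_zero.mp h0).symm⟩
      · exfalso
        refine Nat.find_min hex (m := (x - q * g).norm.toNat) ?_ ⟨_, hmem, h0, rfl⟩
        rw [← hk]
        have := norm_nonneg (x - q * g)
        omega
    · rw [Submodule.span_singleton_le_iff_mem]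
      exact hg

theorem quot_equiv {A : Type} [AddCommGroup A] (I : Ideal E) (g : E →+ A)
    (hs : Function.Surjective g) (hk : ∀ z, g z = 0 ↔ z ∈ I) (al : A →+ A)
    (hg : ∀ z, g (om * z) = al (g z)) :
    ∃ f : (E ⧸ I) ≃ A, ∀ x y, f (om • x + (y - om • y)) = al (f x) + (f y - al (f y)) := by
  have key : ∀ z w : E, (Ideal.Quotient.mk I z = Ideal.Quotient.mk I w) ↔ g z = g w := by
    intro z w
    rw [Ideal.Quotient.eq, ← hk, map_sub, sub_eq_zero]
  let k : A → E ⧸ I := fun a => Ideal.Quotient.mk I (Function.surjInv hs a)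
  have hkb : Function.Bijective k := by
    constructor
    · intro a b hab
      have := (key _ _).mp hab
      rwa [Function.surjInv_eq hs, Function.surjInv_eq hs] at this
    · intro x
      obtain ⟨z, rfl⟩ := Ideal.Quotient.mk_surjective x
      exact ⟨g z, (key _ _).mpr (Function.surjInv_eq hs _)⟩
  have hf : ∀ z, (Equiv.ofBijective k hkb).symm (Ideal.Quotient.mk I z) = g z := by
    intro z
    rw [Equiv.symm_apply_eq]
    exact ((key _ _).mpr (Function.surjInv_eq hs _)).symm
  refine ⟨(Equiv.ofBijective k hkb).symm, ?_⟩
  intro x y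
  obtain ⟨z, rfl⟩ := Ideal.Quotient.mk_surjective x
  obtain ⟨w, rfl⟩ := Ideal.Quotient.mk_surjective y
  have : om • Ideal.Quotient.mk I z + (Ideal.Quotient.mk I w - om • Ideal.Quotient.mk I w) =
    Ideal.Quotient.mk I (om * z + (w - om * w)) := rfl
  rw [this, hf, hf, hf, map_add, map_sub, hg, hg]

theorem root_mod_p (p : ℕ) (hp : p.Prime) (h : p % 3 = 1) :
    ∃ c : ℤ, (p : ℤ) ∣ c ^ 2 - c + 1 := by
  have := Fact.mk hp
  have h3 : Fact (Nat.Prime 3) := ⟨Nat.prime_three⟩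
  obtain ⟨u, hu⟩ := exists_prime_orderOf_dvd_card (G := (ZMod p)ˣ) 3 (by
    rw [ZMod.card_units]; omega)
  have h1 : (u : ZMod p) ^ 3 = 1 := by
    rw [← Units.val_pow_eq_pow_val, ← hu, pow_orderOf_eq_one]; rfl
  have h2 : (u : ZMod p) ≠ 1 := by
    intro h2
    have : u = 1 := Units.ext h2
    rw [this, orderOf_one] at hu
    omega
  have h4 : (u : ZMod p) ^ 2 + u + 1 = 0 := by
    apply mul_left_cancel₀ (sub_ne_zero.mpr h2)
    linear_combination h1
  obtain ⟨c, hc⟩ := ZMod.intCast_surjective (-(u : ZMod p))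
  refine ⟨c, ?_⟩
  rw [← ZMod.intCast_zmod_eq_zero_iff_dvd]
  push_cast
  rw [hc]
  linear_combination h4

theorem not_dvd_disc (p : ℕ) (hp : p.Prime) (h : p % 3 = 1) (c : ℤ)
    (hc : (p : ℤ) ∣ c ^ 2 - c + 1) : ¬ (p : ℤ) ∣ 2 * c - 1 := by
  intro hd
  have h3 : (p : ℤ) ∣ 3 := by
    have : (3 : ℤ) = 4 * (c ^ 2 - c + 1) - (2 * c - 1) * (2 * c - 1) := by ring
    rw [this]
    exact dvd_sub (Dvd.dvd.mul_left hc _) (Dvd.dvd.mul_left hd _)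
  have h4 : p ∣ 3 := by exact_mod_cast h3
  have := (Nat.prime_dvd_prime_iff_eq hp Nat.prime_three).mp h4
  omega

theorem root_mod_pow (p : ℕ) (hp : p.Prime) (h : p % 3 = 1) (n : ℕ) :
    ∃ c : ℤ, (p : ℤ) ^ (n + 1) ∣ c ^ 2 - c + 1 := by
  induction n with
  | zero => simpa using root_mod_p p hp h
  | succ n ih =>
    obtain ⟨c, k, hk⟩ := ih
    have hpc : (p : ℤ) ∣ c ^ 2 - c + 1 := ⟨p ^ n * k, by rw [hk]; ring⟩
    have hcop : IsCoprime (p : ℤ) (2 * c - 1) :=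
      ((Nat.prime_iff_prime_int.mp hp).coprime_iff_not_dvd).mpr (not_dvd_disc p hp h c hpc)
    obtain ⟨u, v, huv⟩ := hcop
    refine ⟨c - p ^ (n + 1) * (k * v), ?_⟩
    refine ⟨k * u + p ^ n * (k * v) ^ 2, ?_⟩
    have : (c - (p : ℤ) ^ (n + 1) * (k * v)) ^ 2 - (c - p ^ (n + 1) * (k * v)) + 1 =
      (c ^ 2 - c + 1) - p ^ (n + 1) * (k * v * (2 * c - 1)) + (p ^ (n + 1) * (k * v)) ^ 2 := by ring
    rw [this, hk]
    have h2 : v * (2 * c - 1) = 1 - u * p := by linear_combination huv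
    have h3 : k * v * (2 * c - 1) = k * (1 - u * p) := by rw [← h2]; ring
    rw [h3]; ring

theorem case1 (p : ℕ) (hp : p.Prime) (h : p % 3 = 1) (P : E) (hP : Prime P) (hPp : P ∣ (p : E))
    (e : ℕ) (he : e ≠ 0) :
    ∃ t : ℕ, 1 ≤ t ∧ ∃ a : ZMod (p ^ t), a ^ 2 - a + 1 = 0 ∧
      ∃ f : (E ⧸ Ideal.span {P ^ e}) ≃ ZMod (p ^ t), ∀ x y,
        f (om • x + (y - om • y)) = a * f x + (1 - a) * f y := by
  obtain ⟨n, rfl⟩ := Nat.exists_eq_succ_of_ne_zero he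
  obtain ⟨c, hc⟩ := root_mod_pow p hp h n
  have hpc : (p : ℤ) ∣ c ^ 2 - c + 1 := (dvd_pow_self _ n.succ_ne_zero).trans hc
  have hprod : P ^ (n + 1) ∣ ((c : E) - om) * ((c : E) - 1 + om) := by
    have e1 : ((c : E) - om) * ((c : E) - 1 + om) = ((c ^ 2 - c + 1 : ℤ) : E) := by
      have hw : om * om = om - 1 := by
        ext
        · simp only [QuadraticAlgebra.re_mul, QuadraticAlgebra.re_sub, QuadraticAlgebra.re_one]; simp
        · simp only [QuadraticAlgebra.im_mul, QuadraticAlgebra.im_sub, QuadraticAlgebra.im_one]; simp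
      push_cast
      linear_combination (-1 : E) * hw
    rw [e1]
    refine (pow_dvd_pow_of_dvd hPp (n + 1)).trans ?_
    have := (Int.castRingHom E).map_dvd hc
    simpa using this
  have hd : ∃ d : ℤ, P ^ (n + 1) ∣ (d : E) - om ∧ (p : ℤ) ^ (n + 1) ∣ d ^ 2 - d + 1 := by
    by_cases h1 : P ∣ (c : E) - om
    · have h2 : ¬ P ∣ (c : E) - 1 + om := by
        intro h2
        have h3 : P ∣ ((2 * c - 1 : ℤ) : E) := by
          have := dvd_add h1 h2
          convert this using 1
          push_cast; ring
        have hcop : IsCoprime (p : ℤ) (2 * c - 1) :=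
          ((Nat.prime_iff_prime_int.mp hp).coprime_iff_not_dvd).mpr (not_dvd_disc p hp h c hpc)
        obtain ⟨u, v, huv⟩ := hcop
        have h4 : P ∣ ((u * p + v * (2 * c - 1) : ℤ) : E) := by
          rw [Int.cast_add, Int.cast_mul, Int.cast_mul]
          exact dvd_add (Dvd.dvd.mul_left (by simpa using hPp) _) (Dvd.dvd.mul_left h3 _)
        rw [huv, Int.cast_one] at h4
        exact hP.not_isUnit (isUnit_of_dvd_one h4)
      exact ⟨c, hP.pow_dvd_of_dvd_mul_right _ h2 hprod, hc⟩
    · have h2 := hP.pow_dvd_of_dvd_mul_left _ h1 hprod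
      refine ⟨1 - c, ?_, ?_⟩
      · have := (dvd_neg (a := P ^ (n + 1))).mpr h2
        convert this using 1
        push_cast; ring
      · convert hc using 1; ring
  obtain ⟨d, hd1, hd2⟩ := hd
  set I : Ideal E := Ideal.span {P ^ (n + 1)} with hI
  obtain ⟨m, hm⟩ := CharP.exists (E ⧸ I)
  have hm1 : m ∣ p ^ (n + 1) := by
    rw [← CharP.cast_eq_zero_iff (E ⧸ I) m]
    have : ((p ^ (n + 1) : ℕ) : E ⧸ I) = Ideal.Quotient.mk I ((p : E) ^ (n + 1)) := by simp
    rw [this, Ideal.Quotient.eq_zero_iff_mem, hI, Ideal.mem_span_singleton]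
    exact pow_dvd_pow_of_dvd hPp _
  obtain ⟨t, ht, rfl⟩ := (Nat.dvd_prime_pow hp).mp hm1
  have ht0 : t ≠ 0 := by
    rintro rfl
    have h1 : ((1 : ℕ) : E ⧸ I) = 0 := (CharP.cast_eq_zero_iff (E ⧸ I) (p ^ 0) 1).mpr (by simp)
    have h2 : Ideal.Quotient.mk I (1 : E) = 0 := by simpa using h1
    rw [Ideal.Quotient.eq_zero_iff_mem, hI, Ideal.mem_span_singleton] at h2
    exact hP.not_isUnit (isUnit_of_dvd_one ((dvd_pow_self P n.succ_ne_zero).trans h2))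
  have ha : (d : ZMod (p ^ t)) ^ 2 - d + 1 = 0 := by
    have : ((d ^ 2 - d + 1 : ℤ) : ZMod (p ^ t)) = 0 := by
      rw [ZMod.intCast_zmod_eq_zero_iff_dvd]
      push_cast
      exact (pow_dvd_pow _ ht).trans hd2
    simpa using this
  refine ⟨t, by omega, (d : ZMod (p ^ t)), ha, ?_⟩
  let g : E →+ ZMod (p ^ t) :=
    { toFun := fun z => (z.re : ZMod (p ^ t)) + z.im * d
      map_zero' := by simp
      map_add' := fun z w => by simp; ring }
  have hgdef : ∀ z, g z = (z.re : ZMod (p ^ t)) + z.im * d := fun z => rfl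
  obtain ⟨f, hf⟩ := quot_equiv I g (fun a => by
      obtain ⟨k, rfl⟩ := ZMod.intCast_surjective a
      exact ⟨(k : E), by simp [hgdef]⟩) (fun z => by
      have h1 : g z = ((z.re + z.im * d : ℤ) : ZMod (p ^ t)) := by simp [hgdef]
      rw [h1, ZMod.intCast_zmod_eq_zero_iff_dvd, ← CharP.intCast_eq_zero_iff (E ⧸ I) (p ^ t),
        ← Ideal.Quotient.eq_zero_iff_mem]
      have h2 : ((z.re + z.im * d : ℤ) : E ⧸ I) = Ideal.Quotient.mk I ((z.re + z.im * d : ℤ) : E) := by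
        simp
      have h3 : Ideal.Quotient.mk I ((z.re + z.im * d : ℤ) : E) = Ideal.Quotient.mk I z := by
        rw [Ideal.Quotient.eq, hI, Ideal.mem_span_singleton]
        have : ((z.re + z.im * d : ℤ) : E) - z = z.im * ((d : E) - om) := by
          ext <;> simp
        rw [this]
        exact Dvd.dvd.mul_left hd1 _
      rw [h2, h3]) (AddMonoidHom.mulLeft (d : ZMod (p ^ t))) (fun z => by
      simp only [hgdef, AddMonoidHom.coe_mulLeft]
      simp
      linear_combination (-(z.im : ZMod (p ^ t))) * ha)
  refine ⟨f, fun x y => ?_⟩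
  rw [hf]
  simp only [AddMonoidHom.coe_mulLeft]
  ring

theorem inert (q : ℕ) (hq : q.Prime) (h : q % 3 = 2) (P : E) (hP : Prime P) (hPq : P ∣ (q : E)) :
    (q : E) ∣ P := by
  have := Fact.mk hq
  have hqi := Nat.prime_iff_prime_int.mp hq
  have h1 : P.norm ∣ (q : ℤ) ^ 2 := by
    have := map_dvd QuadraticAlgebra.norm hPq
    rwa [QuadraticAlgebra.norm_natCast] at this
  have h2 : ¬ IsUnit P.norm := fun hu =>
    hP.not_isUnit (QuadraticAlgebra.isUnit_iff_norm_isUnit.mpr hu)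
  have h3 : (q : ℤ) ∣ P.norm := by
    have hn := norm_nonneg P
    obtain ⟨N, hN⟩ := Int.eq_ofNat_of_zero_le hn
    rw [hN] at h1 h2 ⊢
    have h4 : N ∣ q ^ 2 := by exact_mod_cast h1
    obtain ⟨t, ht, rfl⟩ := (Nat.dvd_prime_pow hq).mp h4
    have : t ≠ 0 := by rintro rfl; simp at h2
    exact_mod_cast dvd_pow_self q this
  rw [norm_eq] at h3
  have h4 : (P.re : ZMod q) ^ 2 + P.re * P.im + P.im ^ 2 = 0 := by
    have := (ZMod.intCast_zmod_eq_zero_iff_dvd _ q).mpr h3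
    simpa using this
  have key : ∀ r : ZMod q, r ^ 2 + r + 1 ≠ 0 := by
    intro r hr
    have hr3 : r ^ 3 = 1 := by linear_combination (r - 1) * hr
    have hr0 : r ≠ 0 := by rintro rfl; simp at hr3
    have h5 := ZMod.pow_card_sub_one_eq_one hr0
    have h6 : q - 1 = 3 * (q / 3) + 1 := by omega
    rw [h6, pow_succ, pow_mul, hr3, one_pow, one_mul] at h5
    rw [h5] at hr
    have h7 : ((3 : ℕ) : ZMod q) = 0 := by push_cast; linear_combination hr
    rw [ZMod.natCast_eq_zero_iff] at h7
    have := (Nat.prime_dvd_prime_iff_eq hq Nat.prime_three).mp h7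
    omega
  have him : (P.im : ZMod q) = 0 := by
    by_contra him
    apply key (P.re / P.im)
    field_simp
    linear_combination h4
  have hre : (P.re : ZMod q) = 0 := by
    rw [him] at h4
    simpa using h4
  rw [ZMod.intCast_zmod_eq_zero_iff_dvd] at him hre
  obtain ⟨a, ha⟩ := hre
  obtain ⟨b, hb⟩ := him
  exact ⟨⟨a, b⟩, by ext <;> simp [ha, hb]⟩

theorem case2 (q : ℕ) (hq : q.Prime) (h : q % 3 = 2) (P : E) (hP : Prime P) (hPq : P ∣ (q : E))
    (e : ℕ) :
      ∃ f : (E ⧸ Ideal.span {P ^ e}) ≃ (Fin 2 → ZMod (q ^ e)), ∀ x y,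
        f (om • x + (y - om • y)) = Matrix.vecMul (f x) (!![0, -1; 1, 1]) +
                Matrix.vecMul (f y) (1 - !![0, -1; 1, 1]) := by
  have hass : Associated P (q : E) := associated_of_dvd_dvd hPq (inert q hq h P hP hPq)
  have hI : Ideal.span {P ^ e} = Ideal.span {(q : E) ^ e} :=
    Ideal.span_singleton_eq_span_singleton.mpr (hass.pow_pow)
  rw [hI]
  let g : E →+ (Fin 2 → ZMod (q ^ e)) :=
    { toFun := fun z => ![(z.re : ZMod (q ^ e)), -z.im]
      map_zero' := by simp
      map_add' := fun z w => by simp; ring }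
  have hgdef : ∀ z, g z = ![(z.re : ZMod (q ^ e)), -z.im] := fun z => rfl
  obtain ⟨f, hf⟩ := quot_equiv (Ideal.span {(q : E) ^ e}) g (fun a => by
      obtain ⟨k, hk⟩ := ZMod.intCast_surjective (a 0)
      obtain ⟨l, hl⟩ := ZMod.intCast_surjective (-a 1)
      refine ⟨⟨k, l⟩, ?_⟩
      ext i
      fin_cases i <;> simp [hgdef, hk, hl]) (fun z => by
      have hq' : (q : E) ^ e = ((q ^ e : ℤ) : E) := by simp
      rw [Ideal.mem_span_singleton, hgdef, hq']
      constructor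
      · intro h0
        have a0 := congrFun h0 0
        have a1 := congrFun h0 1
        simp only [Matrix.cons_val_zero, Matrix.cons_val_one, Pi.zero_apply, neg_eq_zero] at a0 a1
        rw [ZMod.intCast_zmod_eq_zero_iff_dvd] at a0 a1
        obtain ⟨a, ha⟩ := a0
        obtain ⟨b, hb⟩ := a1
        push_cast at ha hb
        refine ⟨⟨a, b⟩, ?_⟩
        ext
        · rw [QuadraticAlgebra.re_mul, QuadraticAlgebra.re_intCast, QuadraticAlgebra.im_intCast, ha]
          simp
        · rw [QuadraticAlgebra.im_mul, QuadraticAlgebra.re_intCast, QuadraticAlgebra.im_intCast, hb]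
          simp
      · rintro ⟨w, rfl⟩
        have h0 : (q : ZMod (q ^ e)) ^ e = 0 := by
          rw [← Nat.cast_pow, ZMod.natCast_self]
        ext i
        fin_cases i
        · simp only [QuadraticAlgebra.re_mul, QuadraticAlgebra.re_intCast, QuadraticAlgebra.im_intCast]
          simp [h0]
        · simp only [QuadraticAlgebra.im_mul, QuadraticAlgebra.re_intCast, QuadraticAlgebra.im_intCast]
          simp [h0])
      (Matrix.vecMulLinear (!![0, -1; 1, 1] : Matrix (Fin 2) (Fin 2) (ZMod (q ^ e)))).toAddMonoidHom
      (fun z => by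
        simp only [hgdef]
        ext i
        fin_cases i
        · simp [Matrix.vecMul, dotProduct]
        · simp [Matrix.vecMul, dotProduct]; ring)
  refine ⟨f, fun x y => ?_⟩
  rw [hf, Matrix.vecMul_sub, Matrix.vecMul_one]
  rfl

theorem exists_prime (P : E) (hP : Prime P) (n : ℕ) (hn : Nat.Coprime n 3) (hd : P ∣ (n : E)) :
    ∃ p : ℕ, p.Prime ∧ (p % 3 = 1 ∨ p % 3 = 2) ∧ P ∣ (p : E) := by
  have hn0 : n ≠ 0 := by rintro rfl; simp at hn
  have h1 : (n : E) = (n.primeFactorsList.map (Nat.cast : ℕ → E)).prod := by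
    have := congrArg (Nat.cast : ℕ → E) (Nat.prod_primeFactorsList hn0)
    rw [← this, Nat.cast_list_prod]
  rw [h1, hP.dvd_prod_iff] at hd
  obtain ⟨a, ha, hPa⟩ := hd
  obtain ⟨p, hp, rfl⟩ := List.mem_map.mp ha
  have hpp := Nat.prime_of_mem_primeFactorsList hp
  refine ⟨p, hpp, ?_, hPa⟩
  have hpn := Nat.dvd_of_mem_primeFactorsList hp
  have : p % 3 ≠ 0 := by
    intro h0
    have h3 : 3 ∣ p := Nat.dvd_of_mod_eq_zero h0
    have := Nat.dvd_gcd (h3.trans hpn) (dvd_refl 3)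
    rw [hn] at this
    omega
  omega

theorem module_class {M : Type} [AddCommGroup M] [Fintype M] (al : M →+ M)
    (hal : ∀ x, al (al x) = al x - x) (hcop : Nat.Coprime (Fintype.card M) 3) :
    ∃ (I : Type) (_ : Fintype I) (P : I → E) (e : I → ℕ),
      (∀ i, Prime (P i) ∧ e i ≠ 0 ∧ P i ^ e i ∣ ((Fintype.card M : ℕ) : E)) ∧
      ∃ f : M ≃ (∀ i, E ⧸ Ideal.span {P i ^ e i}), ∀ x y i,
        f (al x + (y - al y)) i = om • f x i + (f y i - om • f y i) := by
  classical
  let u : AddMonoid.End M := al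
  have hu : u * u = (-1 : ℤ) • (1 : AddMonoid.End M) + (1 : ℤ) • u := by
    ext x
    have h1 : ((-1 : ℤ) • (1 : AddMonoid.End M) + (1 : ℤ) • u) x = -x + al x := by
      simp only [neg_smul, one_smul]; rfl
    exact (hal x).trans (by rw [h1]; abel)
  let φ : E →ₐ[ℤ] AddMonoid.End M := QuadraticAlgebra.lift ⟨u, hu⟩
  let _ : Module E M := Module.compHom M φ.toRingHom
  have hom : ∀ x : M, om • x = al x := by
    intro x
    have : om • x = φ om x := rfl
    rw [this]
    have h2 : φ om = u := by simp [φ]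
    rw [h2]
    rfl
  have hcard : ∀ x : M, ((Fintype.card M : ℕ) : E) • x = 0 := by
    intro x
    rw [Nat.cast_smul_eq_nsmul, card_nsmul_eq_zero]
  have htors : Module.IsTorsion E M := by
    intro x
    refine ⟨⟨((Fintype.card M : ℕ) : E), mem_nonZeroDivisors_of_ne_zero ?_⟩, hcard x⟩
    intro h0
    have := congrArg QuadraticAlgebra.re h0
    simp at this
  obtain ⟨ι, hι, P, hP, e, ⟨F⟩⟩ := Module.equiv_directSum_of_isTorsion (R := E) (M := M) htors
  let G := F.trans (DirectSum.linearEquivFunOnFintype E ι (fun i => E ⧸ Submodule.span E {P i ^ e i}))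
  let J := {i : ι // e i ≠ 0}
  have hsub : ∀ i, e i = 0 → Subsingleton (E ⧸ Submodule.span E {P i ^ e i}) := by
    intro i hi
    rw [hi, pow_zero]
    exact Ideal.Quotient.subsingleton_iff.mpr Ideal.span_singleton_one
  let f0 : M → (∀ i : J, E ⧸ Ideal.span {P i.1 ^ e i.1}) := fun x i => G x i.1
  have hf0 : Function.Bijective f0 := by
    constructor
    · intro x y hxy
      apply G.injective
      funext i
      by_cases hi : e i = 0
      · have := hsub i hi
        exact Subsingleton.elim _ _
      · exact congrFun hxy ⟨i, hi⟩
    · intro y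
      refine ⟨G.symm (fun i => if hi : e i ≠ 0 then y ⟨i, hi⟩ else 0), ?_⟩
      funext i
      simp only [f0, LinearEquiv.apply_symm_apply]
      rw [dif_pos i.2]
  refine ⟨J, inferInstance, fun i => P i.1, fun i => e i.1, ?_, Equiv.ofBijective f0 hf0, ?_⟩
  · intro i
    refine ⟨(hP i.1).prime, i.2, ?_⟩
    have h1 := congrArg (fun z => G z i.1)
      (hcard (G.symm (Pi.single i.1 (Submodule.Quotient.mk 1))))
    simp only [map_smul, LinearEquiv.apply_symm_apply, map_zero, Pi.smul_apply, Pi.single_eq_same,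
      Pi.zero_apply] at h1
    rw [← Submodule.Quotient.mk_smul, Submodule.Quotient.mk_eq_zero, smul_eq_mul, mul_one] at h1
    exact Ideal.mem_span_singleton.mp h1
  · intro x y i
    simp only [Equiv.ofBijective_apply, f0]
    rw [← hom, ← hom, map_add, map_sub, map_smul, map_smul]
    rfl
end DNR

/-- **Classification of distributive, non-ramified Mendelsohn triple systems.**
A finite nonempty distributive Mendelsohn quasigroup `Q` (idempotent,
semisymmetric, left self-distributive quasigroup) whose order is coprime to 3
is isomorphic, as a magma, to a finite direct product of magmas, each of which
is either `Lin(ZMod (p^t), a)` with `p ≡ 1 (mod 3)` prime, `t ≥ 1`, and `a` a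
root of `X² - X + 1` in `ZMod (p^t)`, or `Lin((ZMod (q^u))², T)` with
`q ≡ 2 (mod 3)` prime, `u ≥ 1`, and `T` the companion matrix `!![0, -1; 1, 1]`
of `X² - X + 1`. -/
theorem dnr_mts_classification
    {Q : Type} [Fintype Q] [Nonempty Q] [Mul Q]
    (hleft : ∀ a : Q, Function.Bijective fun x : Q => a * x)
    (hright : ∀ a : Q, Function.Bijective fun x : Q => x * a)
    (idem : ∀ x : Q, x * x = x)
    (semi : ∀ x y : Q, y * (x * y) = x)
    (ldist : ∀ x y z : Q, x * (y * z) = (x * y) * (x * z))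
    (hcop : Nat.Coprime (Fintype.card Q) 3) :
    ∃ (I : Type) (_ : Fintype I) (C : I → Type) (inst : ∀ i, Mul (C i)),
      (∀ i : I,
        (∃ (p t : ℕ), p.Prime ∧ p % 3 = 1 ∧ 1 ≤ t ∧
          ∃ a : ZMod (p ^ t), a ^ 2 - a + 1 = 0 ∧
            ∃ f : C i ≃ ZMod (p ^ t), ∀ x y : C i,
              f ((inst i).mul x y) = a * f x + (1 - a) * f y) ∨
        (∃ (q u : ℕ), q.Prime ∧ q % 3 = 2 ∧ 1 ≤ u ∧
          ∃ f : C i ≃ (Fin 2 → ZMod (q ^ u)), ∀ x y : C i,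
            f ((inst i).mul x y) =
              Matrix.vecMul (f x) (!![0, -1; 1, 1]) +
                Matrix.vecMul (f y) (1 - !![0, -1; 1, 1]))) ∧
      ∃ e : Q ≃ (∀ i, C i), ∀ (x y : Q) (i : I),
        e (x * y) i = (inst i).mul (e x i) (e y i) := by
  have h : DNR.MQ Q := ⟨idem, semi, fun x y => (hleft y).1 (semi (y * x) y), ldist⟩
  obtain ⟨hadd, al, hal, hmul⟩ := DNR.affine h hcop
  obtain ⟨I, hI, P, e, hP, f, hf⟩ := DNR.module_class al hal hcop
  refine ⟨I, hI, fun i => DNR.E ⧸ Ideal.span {P i ^ e i},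
    fun i => ⟨fun x y => DNR.om • x + (y - DNR.om • y)⟩, ?_, f, ?_⟩
  · intro i
    obtain ⟨h1, h2, h3⟩ := hP i
    obtain ⟨p, hp, hp3, hPp⟩ := DNR.exists_prime (P i) h1 _ hcop ((dvd_pow_self _ h2).trans h3)
    rcases hp3 with hp3 | hp3
    · left
      obtain ⟨t, ht, a, ha, g, hg⟩ := DNR.case1 p hp hp3 (P i) h1 hPp (e i) h2
      exact ⟨p, t, hp, hp3, ht, a, ha, g, hg⟩
    · right
      obtain ⟨g, hg⟩ := DNR.case2 p hp hp3 (P i) h1 hPp (e i)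
      exact ⟨p, e i, hp, hp3, Nat.one_le_iff_ne_zero.mpr h2, g, hg⟩
  · intro x y i
    rw [hmul]
    exact hf x y i
end

section
/- Let M be a finite abelian group and R an additive automorphism of M satisfying R(R x) − R x + x = 0 for all x ∈ M, with multiplication x·y = R x + y − R y. Then the multiplication is anticommutative (for all x, y, x·y = y·x implies x = y) if and only if 3 does not divide the cardinality of M. -/
/-- **Purity of linear Mendelsohn triple systems.**
For a linear MTS on a finite abelian group `M` given by an additive automorphism `R`
with `R (R x) - R x + x = 0` and multiplication `x·y = R x + y - R y`, the
multiplication is anticommutative iff `3` does not divide the order of `M`. -/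
theorem linear_mts_pure_iff_not_three_dvd_card
    {M : Type} [AddCommGroup M] [Fintype M] (R : M ≃+ M)
    (hR : ∀ x : M, R (R x) - R x + x = 0) :
    (∀ x y : M, R x + y - R y = R y + x - R x → x = y) ↔
      ¬ (3 ∣ Fintype.card M) := by
  have key : ∀ z : M, R z + R z = z → z + z + z = 0 := by
    intro z hz
    have h1 : R (R z) + R (R z) = R z := by rw [← map_add, hz]
    have h2 := hR z
    have h3 : R (R z) = R z - z := by
      rw [← sub_eq_zero, ← h2]; abel
    rw [h3] at h1
    have h4 : R z = z + z := by
      rw [← sub_eq_zero] at h1 ⊢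
      rw [← h1]; abel
    rw [h4] at hz
    rw [← sub_eq_zero] at hz
    rw [← hz]; abel
  constructor
  · intro h hd
    have h0 : ∀ z : M, R z + R z = z → z = 0 := by
      intro z hz
      apply h z 0
      rw [map_zero, add_zero, sub_zero, zero_add, eq_sub_iff_add_eq, hz]
    haveI : Fact (Nat.Prime 3) := ⟨Nat.prime_three⟩
    obtain ⟨z, hz⟩ := exists_prime_addOrderOf_dvd_card 3 hd
    have h3z : z + z + z = 0 := by
      have := addOrderOf_nsmul_eq_zero z
      rw [hz] at this
      rw [← this]; abel
    have hRR : R (R z) = R z - z := by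
      rw [← sub_eq_zero, ← hR z]; abel
    have hw : R z + R z - z = 0 := by
      apply h0
      simp only [map_sub, map_add, hRR]
      rw [← sub_eq_zero]
      have e : -(z + z + z) = 0 := by rw [h3z, neg_zero]
      rw [← e]; abel
    have : z = 0 := h0 z (sub_eq_zero.mp hw)
    rw [this, addOrderOf_zero] at hz
    omega
  · intro hd x y hxy
    have h1 : R (x - y) + R (x - y) = x - y := by
      rw [← sub_eq_zero] at hxy ⊢
      rw [← hxy, map_sub]; abel
    have h2 := key _ h1
    have h3 : addOrderOf (x - y) ∣ 3 := by
      apply addOrderOf_dvd_of_nsmul_eq_zero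
      rw [← h2]; abel
    rcases (Nat.dvd_prime Nat.prime_three).mp h3 with h | h
    · exact sub_eq_zero.mp (AddMonoid.addOrderOf_eq_one_iff.mp h)
    · exact absurd (h ▸ addOrderOf_dvd_card) hd
end

section
/- Let M be a finite abelian group and R an additive automorphism of M satisfying R(R x) − R x + x = 0 for all x ∈ M, with multiplication x·y = R x + y − R y. Then the multiplication is self-orthogonal (for all a, b ∈ M there exists a unique pair (x, y) ∈ M × M with x·y = a and y·x = b) if and only if 3 does not divide the cardinality of M. -/
/-- **Self-orthogonality of linear Mendelsohn triple systems.**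
For a linear MTS on a finite abelian group `M` given by an additive automorphism `R`
with `R (R x) - R x + x = 0` and multiplication `x·y = R x + y - R y`, the
multiplication is self-orthogonal iff `3` does not divide the order of `M`. -/
theorem linear_mts_self_orthogonal_iff_not_three_dvd_card
    {M : Type} [AddCommGroup M] [Fintype M] (R : M ≃+ M)
    (hR : ∀ x : M, R (R x) - R x + x = 0) :
    (∀ a b : M, ∃! p : M × M,
        R p.1 + p.2 - R p.2 = a ∧ R p.2 + p.1 - R p.1 = b) ↔
      ¬ (3 ∣ Fintype.card M) := by
  have hRR : ∀ x : M, R (R x) = R x - x := fun x => by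
    have h := hR x
    have h2 : R (R x) = (R (R x) - R x + x) + (R x - x) := by abel
    rw [h2, h, zero_add]
  constructor
  · intro H hd
    haveI : Fact (Nat.Prime 3) := ⟨Nat.prime_three⟩
    obtain ⟨z, hz⟩ := exists_prime_addOrderOf_dvd_card 3 hd
    have hz3 : (3 : ℕ) • z = 0 := by rw [← hz]; exact addOrderOf_nsmul_eq_zero z
    have hz0 : z ≠ 0 := by
      rintro rfl
      simp at hz
    have key : ∀ w : M, R w + R w - w = 0 → w = 0 := by
      intro w hw
      have hu := (H 0 0).unique (y₁ := (w, -w)) (y₂ := (0, 0))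
        ⟨by simp only [map_neg]; rw [← hw]; abel,
         by
          simp only [map_neg]
          have : -R w + w - R w = -(R w + R w - w) := by abel
          rw [this, hw, neg_zero]⟩ (by simp)
      exact congrArg Prod.fst hu
    apply hz0
    apply key
    apply key
    simp only [map_add, map_sub, hRR]
    have : R z - z + (R z - z) - R z + (R z - z + (R z - z) - R z) - (R z + R z - z)
        = -((3 : ℕ) • z) := by abel
    rw [this, hz3, neg_zero]
  · intro hd
    have h3 : ∀ x : M, (3 : ℕ) • x = 0 → x = 0 := by
      intro x hx
      have h1 : addOrderOf x ∣ 3 := addOrderOf_dvd_of_nsmul_eq_zero hx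
      rcases (Nat.dvd_prime Nat.prime_three).1 h1 with h | h
      · exact AddMonoid.addOrderOf_eq_one_iff.1 h
      · exact absurd (h ▸ addOrderOf_dvd_card) hd
    let f : M × M →+ M × M :=
      { toFun := fun p => (R p.1 + p.2 - R p.2, R p.2 + p.1 - R p.1)
        map_zero' := by simp
        map_add' := by
          intro p q
          ext <;> simp only [Prod.fst_add, Prod.snd_add, map_add] <;> abel }
    have hf : Function.Injective f := by
      rw [injective_iff_map_eq_zero]
      rintro ⟨x, y⟩ h
      have e1 : R x + y - R y = 0 := congrArg Prod.fst h
      have e2 : R y + x - R x = 0 := congrArg Prod.snd h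
      have hy : y = -x := by
        have : y + x = (R x + y - R y) + (R y + x - R x) := by abel
        rw [e1, e2, add_zero] at this
        exact eq_neg_of_add_eq_zero_left this
      subst hy
      rw [map_neg] at e1
      have e3 := congrArg R e1
      simp only [map_add, map_sub, map_neg, map_zero, hRR] at e3
      have hx : x = 0 := by
        apply h3
        have : (3 : ℕ) • x = (R x + -x - -R x) - ((R x - x + -R x - -(R x - x))
          + (R x - x + -R x - -(R x - x))) := by abel
        rw [this, e1, e3]; simp
      simp [hx]
    have hb := Finite.injective_iff_bijective.1 hf
    intro a b
    obtain ⟨p, hp, hu⟩ := hb.existsUnique (a, b)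
    refine ⟨p, ⟨congrArg Prod.fst hp, congrArg Prod.snd hp⟩, ?_⟩
    rintro q ⟨h1, h2⟩
    exact hu q (Prod.ext h1 h2)
end

section
/- Let M be an abelian group and R an additive automorphism of M satisfying R(R x) − R x + x = 0 for all x ∈ M. Define x ∘ y = −R x + R(R y). Then: (1) x ∘ (x ∘ (x ∘ y)) = y for all x, y ∈ M (the left Eisenstein law); and (2) R x + (y − R y) = (−x) ∘ (−y) for all x, y ∈ M, so that the Mendelsohn multiplication x·y = R x + y − R y is a principal isotope of ∘ via the pair of bijections (negation, negation). -/
/-- **Reverse-linearization: principal isotopy with a left Eisenstein quasigroup.**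
Given an additive automorphism `R` of an abelian group `M` with
`R (R x) - R x + x = 0`, the operation `x ∘ y = -R x + R (R y)` satisfies the
left Eisenstein law `x ∘ (x ∘ (x ∘ y)) = y`, and the Mendelsohn multiplication
`x·y = R x + (y - R y)` satisfies `x·y = (-x) ∘ (-y)`, i.e. it is a principal
isotope of `∘` via the pair of bijections (negation, negation). -/
theorem mendelsohn_principal_isotope_left_eisenstein
    {M : Type} [AddCommGroup M] (R : M ≃+ M)
    (hR : ∀ x : M, R (R x) - R x + x = 0) :
    (∀ x y : M,
        -R x + R (R (-R x + R (R (-R x + R (R y))))) = y) ∧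
    (∀ x y : M, R x + (y - R y) = -R (-x) + R (R (-y))) := by
  have h : ∀ x : M, R (R x) = R x - x := fun x => by
    have := hR x
    rw [← sub_eq_zero, ← this]
    abel
  constructor
  · intro x y
    simp only [map_add, map_neg, map_sub, h]
    abel
  · intro x y
    simp only [map_neg, h]
    abel
end

section
/- Let E = ℤ[X]/(X² − X + 1) be the Eisenstein integers, with ζ the class of X. Let a, b ∈ ℤ be coprime integers, not both zero, and set k = a² + ab + b². Then the quotient ring E/(a + bζ) is isomorphic as a ring to ℤ/kℤ (i.e., to ZMod k). -/
open Polynomial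

/-- The Eisenstein integers `ℤ[X]/(X² - X + 1)`. -/
noncomputable abbrev Eisenstein : Type :=
  AdjoinRoot ((X : ℤ[X]) ^ 2 - X + 1)

/-- The class `ζ` of `X` in the Eisenstein integers. -/
noncomputable abbrev eisensteinZeta : Eisenstein :=
  AdjoinRoot.root ((X : ℤ[X]) ^ 2 - X + 1)

/-- If `a, b` are coprime integers, not both zero, and `k = a² + ab + b²`, then
`ℤ[ζ]/(a + bζ) ≅ ℤ/kℤ`. -/
theorem eisenstein_quotient_coprime (a b : ℤ) (hab : Int.gcd a b = 1)
    (h0 : ¬ (a = 0 ∧ b = 0)) :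
    Nonempty
      ((Eisenstein ⧸ Ideal.span {(a : Eisenstein) + (b : Eisenstein) * eisensteinZeta}) ≃+*
        ZMod (a ^ 2 + a * b + b ^ 2).natAbs) := by
  obtain ⟨u, v, huv⟩ : IsCoprime a b := Int.isCoprime_iff_gcd_eq_one.mpr hab
  set k : ℤ := a ^ 2 + a * b + b ^ 2 with hk
  set r : ℤ := u * b + u * a - v * a with hr
  set I : Ideal Eisenstein :=
    Ideal.span {(a : Eisenstein) + (b : Eisenstein) * eisensteinZeta} with hI
  have hz : eisensteinZeta ^ 2 - eisensteinZeta + 1 = 0 := by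
    have h := AdjoinRoot.eval₂_root ((X : ℤ[X]) ^ 2 - X + 1)
    simpa using h
  have e1 : a + b * r = k * u := by
    rw [hr, hk]; linear_combination (-a) * huv
  have e2 : (a + b) * r - b = k * (u - v) := by
    rw [hr, hk]; linear_combination b * huv
  have e3 : k ∣ r ^ 2 - r + 1 := by
    refine ⟨u * ((u - v) * r + v) + (v - u) * (u * r - (u - v)), ?_⟩
    have h1 : b * (r ^ 2 - r + 1) = k * (u * r - (u - v)) := by
      linear_combination r * e1 - e2
    have h2 : (a + b) * (r ^ 2 - r + 1) = k * ((u - v) * r + v) := by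
      linear_combination r * e2 + e1 - e2
    linear_combination u * h2 + (v - u) * h1 - (r ^ 2 - r + 1) * huv
  have hcast : ∀ n : ℤ, k ∣ n → (n : ZMod k.natAbs) = 0 := by
    intro n hn
    rw [ZMod.intCast_zmod_eq_zero_iff_dvd]
    exact Int.natAbs_dvd.mpr hn
  let f : Eisenstein →+* ZMod k.natAbs :=
    AdjoinRoot.lift (Int.castRingHom _) (r : ZMod k.natAbs) (by
      have := hcast _ e3
      push_cast at this
      simpa using this)
  have hfz : f eisensteinZeta = (r : ZMod k.natAbs) := AdjoinRoot.lift_root _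
  have hf : ∀ x ∈ I, f x = 0 := by
    intro x hx
    obtain ⟨y, rfl⟩ := Ideal.mem_span_singleton'.mp hx
    have := hcast _ ⟨u, e1⟩
    push_cast at this
    rw [map_mul, map_add, map_mul, hfz, map_intCast, map_intCast, this, mul_zero]
  let q := Ideal.Quotient.mk I
  have hgen : (a : Eisenstein ⧸ I) + b * q eisensteinZeta = 0 := by
    have : q ((a : Eisenstein) + (b : Eisenstein) * eisensteinZeta) = 0 :=
      Ideal.Quotient.eq_zero_iff_mem.mpr (Ideal.mem_span_singleton_self _)
    simpa only [map_add, map_mul, map_intCast] using this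
  have hz' : (q eisensteinZeta) ^ 2 - q eisensteinZeta + 1 = 0 := by
    have := congrArg q hz
    simpa only [map_add, map_sub, map_pow, map_one, map_zero] using this
  have huv' : (u : Eisenstein ⧸ I) * a + v * b = 1 := by exact_mod_cast congrArg (Int.cast : ℤ → Eisenstein ⧸ I) huv
  have hk0 : ((k : ℤ) : Eisenstein ⧸ I) = 0 := by
    rw [hk]; push_cast
    linear_combination (a + b - b * q eisensteinZeta) * hgen + b ^ 2 * hz'
  have hzr : q eisensteinZeta = ((r : ℤ) : Eisenstein ⧸ I) := by
    rw [hr]; push_cast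
    linear_combination (-q eisensteinZeta) * huv' + (u * q eisensteinZeta + (v - u)) * hgen - u * b * hz'
  have hsurj : ∀ y : Eisenstein ⧸ I, ∃ n : ℤ, (n : Eisenstein ⧸ I) = y := by
    intro y
    obtain ⟨x, rfl⟩ := Ideal.Quotient.mk_surjective y
    obtain ⟨p, rfl⟩ := AdjoinRoot.mk_surjective x
    refine ⟨p.eval r, ?_⟩
    have : (q.comp (AdjoinRoot.mk _)) = (Int.castRingHom (Eisenstein ⧸ I)).comp (evalRingHom r) := by
      apply Polynomial.ringHom_ext
      · intro n; simp
      · simpa using hzr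
    exact (congrArg (fun g : ℤ[X] →+* _ => g p) this).symm
  refine ⟨RingEquiv.ofBijective (Ideal.Quotient.lift I f hf) ⟨?_, ?_⟩⟩
  · rw [injective_iff_map_eq_zero]
    intro y hy
    obtain ⟨n, rfl⟩ := hsurj y
    rw [map_intCast, ZMod.intCast_zmod_eq_zero_iff_dvd] at hy
    obtain ⟨m, rfl⟩ := Int.natAbs_dvd.mp hy
    rw [Int.cast_mul, hk0, zero_mul]
  · intro z
    obtain ⟨n, rfl⟩ := ZMod.intCast_surjective z
    exact ⟨n, map_intCast _ _⟩
end

section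
/- Let E = ℤ[X]/(X² − X + 1) be the Eisenstein integers, with ζ the class of X, and let σ be the ring automorphism of E sending ζ to 1 − ζ (conjugation). Let x, y ∈ ℤ be such that p = x² + xy + y² is a rational prime with p ≡ 1 (mod 3), and set π = x + yζ. Then π is not associated to its conjugate: there is no unit u of E with u·π = σ(π). -/
open Polynomial

lemma eis_monic : ((X : ℤ[X]) ^ 2 - X + 1).Monic := by monicity!

lemma eis_deg : ((X : ℤ[X]) ^ 2 - X + 1).degree = 2 := by compute_degree!

lemma eis_rel : eisensteinZeta ^ 2 = eisensteinZeta - 1 := by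
  have h : AdjoinRoot.mk ((X : ℤ[X]) ^ 2 - X + 1) ((X : ℤ[X]) ^ 2 - X + 1) = 0 :=
    AdjoinRoot.mk_self
  simp only [map_add, map_sub, map_pow, map_one, AdjoinRoot.mk_X] at h
  linear_combination h

lemma eis_indep (a b : ℤ) (h : (a : Eisenstein) + (b : Eisenstein) * eisensteinZeta = 0) :
    a = 0 ∧ b = 0 := by
  have h1 : AdjoinRoot.mk ((X : ℤ[X]) ^ 2 - X + 1) (C b * X + C a) = 0 := by
    rw [map_add, map_mul, AdjoinRoot.mk_X, ← h]
    simp [add_comm]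
  rw [AdjoinRoot.mk_eq_zero] at h1
  have h2 : (C b * X + C a : ℤ[X]) = 0 := by
    by_contra h0
    refine eis_monic.not_dvd_of_degree_lt h0 ?_ h1
    rw [eis_deg]
    exact lt_of_le_of_lt degree_linear_le (by norm_num)
  constructor
  · simpa using congrArg (fun q => coeff q 0) h2
  · simpa [coeff_C, -eq_intCast] using congrArg (fun q => coeff q 1) h2

lemma eis_rep (u : Eisenstein) :
    ∃ a b : ℤ, u = (a : Eisenstein) + (b : Eisenstein) * eisensteinZeta := by
  obtain ⟨g, rfl⟩ := AdjoinRoot.mk_surjective u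
  have hlt := degree_modByMonic_lt g eis_monic
  rw [eis_deg] at hlt
  have hle : (g %ₘ ((X : ℤ[X]) ^ 2 - X + 1)).degree ≤ 1 := Order.le_of_lt_succ hlt
  have he := eq_X_add_C_of_degree_le_one hle
  have hm : AdjoinRoot.mk ((X : ℤ[X]) ^ 2 - X + 1) g =
      AdjoinRoot.mk ((X : ℤ[X]) ^ 2 - X + 1) (g %ₘ ((X : ℤ[X]) ^ 2 - X + 1)) := by
    conv_lhs => rw [← modByMonic_add_div g ((X : ℤ[X]) ^ 2 - X + 1)]
    rw [map_add, map_mul, AdjoinRoot.mk_self, zero_mul, add_zero]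
  refine ⟨(g %ₘ ((X : ℤ[X]) ^ 2 - X + 1)).coeff 0,
    (g %ₘ ((X : ℤ[X]) ^ 2 - X + 1)).coeff 1, ?_⟩
  rw [hm]
  conv_lhs => rw [he]
  rw [map_add, map_mul, AdjoinRoot.mk_X]
  simp [add_comm]

lemma eis_arith (x y p a b : ℤ) (hp : Prime p) (hp3 : p % 3 = 1)
    (hnorm : x ^ 2 + x * y + y ^ 2 = p)
    (h1 : a * x - b * y = x + y) (h2 : a * y + b * x + b * y = -y) : False := by
  have hsq : ∀ z : ℤ, p ≠ z * z := by
    rintro z rfl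
    rcases hp.irreducible.isUnit_or_isUnit rfl with h | h <;> exact hp.not_isUnit (h.mul h)
  have hN : (a ^ 2 + a * b + b ^ 2) * p = 1 * p := by
    have : (a ^ 2 + a * b + b ^ 2) * (x ^ 2 + x * y + y ^ 2) =
      (a * x - b * y) ^ 2 + (a * x - b * y) * (a * y + b * x + b * y)
        + (a * y + b * x + b * y) ^ 2 := by ring
    rw [← hnorm, this, h1, h2]; ring
  have hN1 := mul_right_cancel₀ hp.ne_zero hN
  have ha : -1 ≤ a ∧ a ≤ 1 := by constructor <;> nlinarith [sq_nonneg (a + 2 * b)]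
  have hb : -1 ≤ b ∧ b ≤ 1 := by constructor <;> nlinarith [sq_nonneg (2 * a + b)]
  obtain ⟨ha1, ha2⟩ := ha
  obtain ⟨hb1, hb2⟩ := hb
  interval_cases a <;> interval_cases b <;> norm_num at hN1
  · obtain rfl : y = -2 * x := by linarith
    have : p = 3 * (x * x) := by rw [← hnorm]; ring
    omega
  · obtain rfl : y = -x := by linarith
    exact hsq x (by rw [← hnorm]; ring)
  · obtain rfl : x = 0 := by linarith
    exact hsq y (by rw [← hnorm]; ring)
  · obtain rfl : x = -2 * y := by linarith
    have : p = 3 * (y * y) := by rw [← hnorm]; ring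
    omega
  · obtain rfl : x = y := by linarith
    have : p = 3 * (x * x) := by rw [← hnorm]; ring
    omega
  · obtain rfl : y = 0 := by linarith
    exact hsq x (by rw [← hnorm]; ring)

/-- An irrational Eisenstein prime `π = x + yζ`, whose norm `p = x² + xy + y²` is a
rational prime congruent to `1 mod 3`, is not associated to its conjugate `σ(π)`,
where `σ` is the conjugation automorphism determined by `σ(ζ) = 1 - ζ`. -/
theorem eisenstein_prime_not_associated_to_conjugate
    (σ : Eisenstein ≃+* Eisenstein) (hσ : σ eisensteinZeta = 1 - eisensteinZeta)
    (x y p : ℤ) (hp : Prime p) (hp3 : p % 3 = 1)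
    (hnorm : x ^ 2 + x * y + y ^ 2 = p) :
    ¬ ∃ u : Eisensteinˣ,
        (u : Eisenstein) * ((x : Eisenstein) + (y : Eisenstein) * eisensteinZeta) =
          σ ((x : Eisenstein) + (y : Eisenstein) * eisensteinZeta) := by
  rintro ⟨u, hu⟩
  obtain ⟨a, b, hab⟩ := eis_rep (u : Eisenstein)
  rw [hab, map_add, map_mul, map_intCast, map_intCast, hσ] at hu
  have h := eis_indep (a * x - b * y - (x + y)) (a * y + b * x + b * y + y) (by
    push_cast
    linear_combination hu - (b : Eisenstein) * (y : Eisenstein) * eis_rel)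
  exact eis_arith x y p a b hp hp3 hnorm (by linarith [h.1]) (by linarith [h.2])
end

section
/- Let E = ℤ[X]/(X² − X + 1) be the Eisenstein integers, with ζ the class of X. Let x, y ∈ ℤ be such that p = x² + xy + y² is a rational prime with p ≡ 1 (mod 3), set π = x + yζ, and let n ≥ 1. If a, b ∈ ℤ satisfy π^n = a + bζ, then gcd(a, b) = 1. -/
open Polynomial

/-- If `π = x + yζ` is an irrational Eisenstein prime (its norm `p = x² + xy + y²`
being a rational prime congruent to `1 mod 3`) and `n ≥ 1`, then writing
`π^n = a + bζ` one has `gcd(a, b) = 1`. -/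
theorem eisenstein_prime_power_coords_coprime
    (x y p : ℤ) (hp : Prime p) (hp3 : p % 3 = 1)
    (hnorm : x ^ 2 + x * y + y ^ 2 = p) (n : ℕ) (hn : 1 ≤ n) (a b : ℤ)
    (hpow : ((x : Eisenstein) + (y : Eisenstein) * eisensteinZeta) ^ n =
        (a : Eisenstein) + (b : Eisenstein) * eisensteinZeta) :
    Int.gcd a b = 1 := by
  by_contra hg
  obtain ⟨q, hq, hqd⟩ := Nat.exists_prime_and_dvd hg
  have : Fact q.Prime := ⟨hq⟩
  have hqa : (q : ℤ) ∣ a := (Int.natCast_dvd_natCast.mpr hqd).trans (Int.gcd_dvd_left a b)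
  have hqb : (q : ℤ) ∣ b := (Int.natCast_dvd_natCast.mpr hqd).trans (Int.gcd_dvd_right a b)
  obtain ⟨K, iF, iA, iC⟩ : ∃ (K : Type) (_ : Field K), IsAlgClosed K ∧ CharP K q :=
    ⟨AlgebraicClosure (ZMod q), inferInstance, inferInstance,
      charP_of_injective_algebraMap
        (algebraMap (ZMod q) (AlgebraicClosure (ZMod q))).injective q⟩
  have hK : ∀ z : ℤ, (z : K) = 0 ↔ (q : ℤ) ∣ z := fun z => CharP.intCast_eq_zero_iff K q z
  have key : ∀ r : K, r ^ 2 - r + 1 = 0 → (x : K) + y * r = 0 := by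
    intro r hr
    let f : Eisenstein →+* K := AdjoinRoot.lift (Int.castRingHom K) r (by simpa using hr)
    have hz : f eisensteinZeta = r := AdjoinRoot.lift_root _
    have h := congrArg f hpow
    rw [map_pow, map_add, map_add, map_mul, map_mul, hz, map_intCast, map_intCast,
      map_intCast, map_intCast, (hK a).2 hqa, (hK b).2 hqb] at h
    exact eq_zero_of_pow_eq_zero (n := n) (by simpa using h)
  obtain ⟨r, hr⟩ : ∃ r : K, r ^ 2 - r + 1 = 0 := by
    have hd : ((X : K[X]) ^ 2 - X + 1).degree = 2 := by compute_degree!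
    obtain ⟨r, hr⟩ := IsAlgClosed.exists_root ((X : K[X]) ^ 2 - X + 1) (by rw [hd]; decide)
    exact ⟨r, by simpa [IsRoot] using hr⟩
  have h1 := key r hr
  have h2 := key (1 - r) (by linear_combination hr)
  have hqp : (q : ℤ) ∣ p := by
    rw [← hK, ← hnorm]
    push_cast
    linear_combination ((x : K) + y * (1 - r)) * h1 + (y : K) ^ 2 * hr
  have hq3 : (q : ℤ) ∣ 3 * y ^ 2 := by
    have h4 : ((4 * p - (2 * x + y) ^ 2 : ℤ) : K) = 0 := by
      have := (hK p).2 hqp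
      push_cast
      linear_combination 4 * this - (2 * (x : K) + y) * (h1 + h2)
    rw [hK] at h4
    rwa [show 3 * y ^ 2 = 4 * p - (2 * x + y) ^ 2 by rw [← hnorm]; ring]
  have hqZ : Prime (q : ℤ) := Nat.prime_iff_prime_int.mp hq
  rcases hqZ.dvd_or_dvd hq3 with h | h
  · have h3 : q ∣ 3 := by exact_mod_cast h
    have : q = 3 := (Nat.prime_dvd_prime_iff_eq hq Nat.prime_three).1 h3
    subst this
    omega
  · have hy := hqZ.dvd_of_dvd_pow h
    have hx : (q : ℤ) ∣ x := by
      apply hqZ.dvd_of_dvd_pow (n := 2)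
      rw [show x ^ 2 = p - y * (x + y) by rw [← hnorm]; ring]
      exact dvd_sub hqp (hy.mul_right _)
    obtain ⟨u, rfl⟩ := hx
    obtain ⟨v, rfl⟩ := hy
    have hpq : p = q * (q * (u ^ 2 + u * v + v ^ 2)) := by rw [← hnorm]; ring
    rcases hp.irreducible.isUnit_or_isUnit hpq with h | h
    · exact hqZ.not_isUnit h
    · exact hqZ.not_isUnit (isUnit_of_mul_isUnit_left h)
end

section
/- Let E = ℤ[X]/(X² − X + 1) be the Eisenstein integers, with ζ the class of X, and let k ≥ 1. Then the quotient ring E/((1 + ζ)^{2k}) is isomorphic as a ring to (ℤ/3^kℤ)[X]/(X² − X + 1), i.e., to AdjoinRoot of the polynomial X² − X + 1 over ZMod (3^k). -/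
open Polynomial

/-- For `k ≥ 1`, the quotient of the Eisenstein integers by an even power
`(1 + ζ)^(2k)` of the ramified prime is isomorphic to `(ℤ/3^kℤ)[X]/(X² - X + 1)`. -/
theorem eisenstein_quotient_ramified_even_power (k : ℕ) (hk : 1 ≤ k) :
    Nonempty
      ((Eisenstein ⧸ Ideal.span {(1 + eisensteinZeta) ^ (2 * k)}) ≃+*
        AdjoinRoot ((X : (ZMod (3 ^ k))[X]) ^ 2 - X + 1)) := by
  have hz : eisensteinZeta ^ 2 - eisensteinZeta + 1 = 0 := by
    have h := AdjoinRoot.eval₂_root ((X : ℤ[X]) ^ 2 - X + 1)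
    simpa using h
  have hI : Ideal.span {(1 + eisensteinZeta) ^ (2 * k)} =
      (Ideal.span {((3 ^ k : ℕ) : ℤ)}).map (AdjoinRoot.of ((X : ℤ[X]) ^ 2 - X + 1)) := by
    rw [Ideal.map_span, Set.image_singleton]
    have h3 : (1 + eisensteinZeta) ^ 2 = 3 * eisensteinZeta := by
      linear_combination hz
    have hu : IsUnit eisensteinZeta :=
      IsUnit.of_mul_eq_one (1 - eisensteinZeta) (by linear_combination -hz)
    rw [pow_mul, h3, mul_pow]
    have e : (AdjoinRoot.of ((X : ℤ[X]) ^ 2 - X + 1)) ((3 ^ k : ℕ) : ℤ) = 3 ^ k := by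
      simp
    rw [e]
    exact Ideal.span_singleton_mul_right_unit (hu.pow k) _
  have e1 := AdjoinRoot.quotAdjoinRootEquivQuotPolynomialQuot (Ideal.span {((3 ^ k : ℕ) : ℤ)})
    ((X : ℤ[X]) ^ 2 - X + 1)
  have e2 : AdjoinRoot (((X : ℤ[X]) ^ 2 - X + 1).map
      (Ideal.Quotient.mk (Ideal.span {((3 ^ k : ℕ) : ℤ)}))) ≃+*
      AdjoinRoot ((X : (ZMod (3 ^ k))[X]) ^ 2 - X + 1) :=
    AdjoinRoot.mapRingEquiv (Int.quotientSpanNatEquivZMod (3 ^ k)) _ _ (by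
      apply Associated.of_eq
      simp only [Polynomial.map_add, Polynomial.map_sub, Polynomial.map_pow, Polynomial.map_X,
        Polynomial.map_one])
  exact ⟨(Ideal.quotEquivOfEq hI).trans (e1.trans e2)⟩
end

section
/- Let p be a prime with p mod 3 ≠ 1 (i.e., p ≡ 2 (mod 3) or p = 3), let n ≥ 1, and let A be a 2×2 matrix over ℤ/p^nℤ satisfying A² − A + 1 = 0 (where 1 denotes the identity matrix). Then det A = 1 and trace A = 1; consequently the characteristic polynomial of A is X² − X + 1. -/
open Polynomial Matrix

lemma aux_unit (p : ℕ) (hp : p.Prime) (n : ℕ) (x : ZMod (p ^ n)) :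
    IsUnit x ∨ ∃ y, x = (p : ZMod (p ^ n)) * y := by
  haveI : NeZero (p ^ n) := ⟨pow_ne_zero _ hp.ne_zero⟩
  by_cases h : p ∣ x.val
  · right
    obtain ⟨k, hk⟩ := h
    refine ⟨k, ?_⟩
    rw [← ZMod.natCast_zmod_val x, hk]
    push_cast
    rfl
  · left
    rw [← ZMod.natCast_zmod_val x, ZMod.isUnit_iff_coprime]
    exact (((Nat.Prime.coprime_iff_not_dvd hp).2 h).symm).pow_right n

lemma aux_noroot (p : ℕ) (hp : p.Prime) (h2 : p % 3 = 2) (a : ZMod p)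
    (h : a ^ 2 - a + 1 = 0) : False := by
  haveI : Fact p.Prime := ⟨hp⟩
  have ha : -a ≠ 0 := by
    intro h0
    have : a = 0 := by simpa using h0
    subst this
    simp at h
  have h3 : (-a) ^ 3 = 1 := by linear_combination (-(a + 1)) * h
  have hf := ZMod.pow_card_sub_one_eq_one ha
  have e : p - 1 = 3 * (p / 3) + 1 := by omega
  rw [e, pow_succ, pow_mul, h3, one_pow, one_mul] at hf
  have h4 : ((3 : ℕ) : ZMod p) = 0 := by
    push_cast
    linear_combination h + (a - 2) * hf
  rw [ZMod.natCast_eq_zero_iff] at h4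
  have := (Nat.prime_dvd_prime_iff_eq hp Nat.prime_three).1 h4
  omega

/-- For a prime `p` with `p mod 3 ≠ 1` and `n ≥ 1`, a 2×2 matrix over `ℤ/p^nℤ`
annihilated by `X² - X + 1` has determinant 1 and trace 1, hence its
characteristic polynomial is `X² - X + 1`. -/
theorem zmod_matrix_root_det_trace_charpoly
    (p : ℕ) (hp : p.Prime) (hp3 : p % 3 ≠ 1) (n : ℕ) (hn : 1 ≤ n)
    (A : Matrix (Fin 2) (Fin 2) (ZMod (p ^ n))) (hA : A ^ 2 - A + 1 = 0) :
    A.det = 1 ∧ A.trace = 1 ∧ A.charpoly = X ^ 2 - X + 1 := by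
  haveI : Fact (1 < p ^ n) := ⟨Nat.one_lt_pow (by omega) hp.one_lt⟩
  suffices H : A.det = 1 ∧ A.trace = 1 by
    refine ⟨H.1, H.2, ?_⟩
    rw [Matrix.charpoly_fin_two, H.1, H.2]
    simp
  have e00 := congrFun (congrFun hA 0) 0
  have e01 := congrFun (congrFun hA 0) 1
  have e10 := congrFun (congrFun hA 1) 0
  have e11 := congrFun (congrFun hA 1) 1
  simp [pow_two, Matrix.mul_apply, Fin.sum_univ_two] at e00 e01 e10 e11
  rw [Matrix.det_fin_two, Matrix.trace_fin_two]
  generalize A 0 0 = a at *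
  generalize A 0 1 = b at *
  generalize A 1 0 = c at *
  generalize A 1 1 = d at *
  have key : a + d - 1 = 0 → a * d - b * c = 1 ∧ a + d = 1 := fun h =>
    ⟨by linear_combination a * h - e00, by linear_combination h⟩
  rcases aux_unit p hp n b with hb | ⟨b', hb⟩
  · exact key (hb.mul_right_eq_zero.1 (by linear_combination e01))
  rcases aux_unit p hp n c with hc | ⟨c', hc⟩
  · exact key (hc.mul_right_eq_zero.1 (by linear_combination e10))
  rcases aux_unit p hp n (a - d) with hd | ⟨d', hd⟩
  · exact key (hd.mul_right_eq_zero.1 (by linear_combination e00 - e11))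
  have hr : a ^ 2 - a + 1 = - (p : ZMod (p ^ n)) ^ 2 * (b' * c') := by
    rw [hb, hc] at e00
    linear_combination e00
  have hcase : p % 3 = 2 ∨ p = 3 := by
    by_cases h : 3 ∣ p
    · exact Or.inr ((Nat.prime_dvd_prime_iff_eq Nat.prime_three hp).1 h).symm
    · omega
  rcases hcase with h2 | rfl
  · exfalso
    have := congrArg (ZMod.castHom (dvd_pow_self p (by omega : n ≠ 0)) (ZMod p)) hr
    simp only [map_add, map_sub, map_mul, map_neg, map_pow, map_one, map_natCast] at this
    exact aux_noroot p hp h2 _ (by rw [this]; simp)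
  · obtain rfl | hn2 : n = 1 ∨ 2 ≤ n := by omega
    · clear hA key hr hn e10 e01
      have h3 : ((3 : ℕ) : ZMod (3 ^ 1)) = 0 := rfl
      rw [h3, zero_mul] at hb hc hd
      subst hb hc
      obtain rfl : a = d := sub_eq_zero.1 hd
      clear * - e00
      revert a
      decide
    · exfalso
      have := congrArg (ZMod.castHom (pow_dvd_pow 3 hn2) (ZMod (3 ^ 2))) hr
      simp only [map_add, map_sub, map_mul, map_neg, map_pow, map_one, map_natCast] at this
      have h9 : ((3 : ℕ) : ZMod (3 ^ 2)) ^ 2 = 0 := rfl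
      rw [h9, neg_zero, zero_mul] at this
      revert this
      generalize (ZMod.castHom (pow_dvd_pow 3 hn2) (ZMod (3 ^ 2))) a = z
      revert z
      decide
end

section
/- Let p be a prime with p ≡ 2 (mod 3), let n ≥ 1, and let A be a 2×2 matrix over ℤ/p^nℤ satisfying A² − A + 1 = 0 (where 1 denotes the identity matrix). Then A is similar to the companion matrix of X² − X + 1: there exists an invertible 2×2 matrix P over ℤ/p^nℤ with P⁻¹·A·P equal to the matrix with rows (0, −1) and (1, 1). -/
open Matrix

lemma aux_no_root (p : ℕ) (hp : p.Prime) (hp3 : p % 3 = 2) (a : ZMod p)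
    (h : a ^ 2 - a + 1 = 0) : False := by
  haveI : Fact p.Prime := ⟨hp⟩
  have h3 : (-a) ^ 3 = 1 := by linear_combination (-(a + 1)) * h
  have h0 : -a ≠ 0 := by
    intro h0
    rw [h0] at h3
    simp at h3
  have hk := ZMod.pow_card_sub_one_eq_one h0
  have e : p - 1 = 3 * (p / 3) + 1 := by omega
  rw [e, pow_succ, pow_mul, h3, one_pow, one_mul] at hk
  have h30 : ((3 : ℕ) : ZMod p) = 0 := by
    push_cast
    linear_combination h + (a - 2) * hk
  rw [ZMod.natCast_eq_zero_iff, Nat.dvd_prime Nat.prime_three] at h30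
  rcases h30 with h | h <;> omega

/-- For a prime `p ≡ 2 (mod 3)` and `n ≥ 1`, any 2×2 matrix over `ℤ/p^nℤ`
annihilated by `X² - X + 1` is similar to the companion matrix of `X² - X + 1`. -/
theorem zmod_matrix_similar_companion
    (p : ℕ) (hp : p.Prime) (hp3 : p % 3 = 2) (n : ℕ) (hn : 1 ≤ n)
    (A : Matrix (Fin 2) (Fin 2) (ZMod (p ^ n))) (hA : A ^ 2 - A + 1 = 0) :
    ∃ P : Matrix (Fin 2) (Fin 2) (ZMod (p ^ n)),
      IsUnit P ∧ P⁻¹ * A * P = !![0, -1; 1, 1] := by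
  have h00 := congrFun (congrFun hA 0) 0
  have h10 := congrFun (congrFun hA 1) 0
  simp [pow_two, Matrix.mul_apply, Fin.sum_univ_two] at h00 h10
  haveI : NeZero (p ^ n) := ⟨pow_ne_zero _ hp.ne_zero⟩
  have hc : IsUnit (A 1 0) := by
    by_contra hc
    rw [← ZMod.natCast_zmod_val (A 1 0), ZMod.isUnit_iff_coprime] at hc
    have hd : p ∣ (A 1 0).val := by
      by_contra hd
      exact hc (((Nat.Prime.coprime_iff_not_dvd hp).2 hd).symm.pow_right n)
    let f := ZMod.castHom (dvd_pow_self p (by omega : n ≠ 0)) (ZMod p)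
    have hf : f (A 1 0) = 0 := by
      rw [← ZMod.natCast_zmod_val (A 1 0), map_natCast, ZMod.natCast_eq_zero_iff]
      exact hd
    have := congrArg f h00
    simp only [map_add, map_sub, map_mul, map_one, map_zero, hf] at this
    exact aux_no_root p hp hp3 (f (A 0 0)) (by linear_combination this)
  have hdet : IsUnit (!![1, A 0 0; 0, A 1 0] : Matrix (Fin 2) (Fin 2) (ZMod (p ^ n))).det := by
    simpa [Matrix.det_fin_two] using hc
  refine ⟨!![1, A 0 0; 0, A 1 0], (Matrix.isUnit_iff_isUnit_det _).2 hdet, ?_⟩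
  have key : A * !![1, A 0 0; 0, A 1 0] = !![1, A 0 0; 0, A 1 0] * !![0, -1; 1, 1] := by
    ext i j
    fin_cases i <;> fin_cases j <;> simp [Matrix.mul_apply, Fin.sum_univ_two]
    · linear_combination h00
    · linear_combination h10
  rw [Matrix.mul_assoc, key, ← Matrix.mul_assoc, Matrix.nonsing_inv_mul _ hdet, Matrix.one_mul]
end

section
/- Let k ≥ 2 and let A be a 2×2 matrix over ℤ/3^kℤ satisfying A² − A + 1 = 0 (where 1 denotes the identity matrix). Then A is similar to the companion matrix of X² − X + 1: there exists an invertible 2×2 matrix P over ℤ/3^kℤ with P⁻¹·A·P equal to the matrix with rows (0, −1) and (1, 1). -/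
open Matrix

lemma three_dvd_of_not_unit (k : ℕ) (x : ZMod (3 ^ k)) (hx : ¬ IsUnit x) : ∃ y, x = 3 * y := by
  have : NeZero (3 ^ k) := ⟨by positivity⟩
  rw [← ZMod.natCast_zmod_val x, ZMod.isUnit_iff_coprime] at hx
  have h3 : 3 ∣ x.val := by
    by_contra h
    exact hx (((Nat.Prime.coprime_iff_not_dvd Nat.prime_three).2 h).symm.pow_right k)
  obtain ⟨m, hm⟩ := h3
  refine ⟨(m : ZMod (3 ^ k)), ?_⟩
  rw [← ZMod.natCast_zmod_val x, hm]
  push_cast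
  rfl

lemma sim_of_vec {R : Type*} [CommRing R] (a b c d s t : R)
    (h00 : a * a + b * c - a + 1 = 0) (h01 : a * b + b * d - b = 0)
    (h10 : c * a + d * c - c = 0) (h11 : c * b + d * d - d + 1 = 0)
    (hu : IsUnit (s * (c * s + d * t) - (a * s + b * t) * t)) :
    ∃ P : Matrix (Fin 2) (Fin 2) R,
      IsUnit P ∧ P⁻¹ * !![a, b; c, d] * P = !![0, -1; 1, 1] := by
  have hd : IsUnit (!![s, a * s + b * t; t, c * s + d * t] : Matrix (Fin 2) (Fin 2) R).det := by
    rw [Matrix.det_fin_two_of]; exact hu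
  refine ⟨!![s, a * s + b * t; t, c * s + d * t], (Matrix.isUnit_iff_isUnit_det _).2 hd, ?_⟩
  have key : !![a, b; c, d] * !![s, a * s + b * t; t, c * s + d * t]
      = !![s, a * s + b * t; t, c * s + d * t] * !![0, -1; 1, 1] := by
    ext i j
    fin_cases i <;> fin_cases j <;> simp [Matrix.mul_apply, Fin.sum_univ_two]
    · linear_combination s * h00 + t * h01
    · linear_combination s * h10 + t * h11
  rw [Matrix.mul_assoc, key, ← Matrix.mul_assoc, Matrix.nonsing_inv_mul _ hd, Matrix.one_mul]

/-- For `k ≥ 2`, any 2×2 matrix over `ℤ/3^kℤ` annihilated by `X² - X + 1` is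
similar to the companion matrix of `X² - X + 1`. -/
theorem zmod_three_pow_matrix_similar_companion
    (k : ℕ) (hk : 2 ≤ k)
    (A : Matrix (Fin 2) (Fin 2) (ZMod (3 ^ k))) (hA : A ^ 2 - A + 1 = 0) :
    ∃ P : Matrix (Fin 2) (Fin 2) (ZMod (3 ^ k)),
      IsUnit P ∧ P⁻¹ * A * P = !![0, -1; 1, 1] := by
  have h00 := congrFun (congrFun hA 0) 0
  have h01 := congrFun (congrFun hA 0) 1
  have h10 := congrFun (congrFun hA 1) 0
  have h11 := congrFun (congrFun hA 1) 1
  simp [pow_two, Matrix.mul_apply, Fin.sum_univ_two] at h00 h01 h10 h11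
  rw [Matrix.eta_fin_two A]
  generalize A 0 0 = a at *
  generalize A 0 1 = b at *
  generalize A 1 0 = c at *
  generalize A 1 1 = d at *
  by_cases hc : IsUnit c
  · exact sim_of_vec a b c d 1 0 h00 h01 h10 h11 (by simpa using hc)
  by_cases hb : IsUnit b
  · exact sim_of_vec a b c d 0 1 h00 h01 h10 h11 (by simpa using hb)
  exfalso
  obtain ⟨b', rfl⟩ := three_dvd_of_not_unit k b hb
  obtain ⟨c', rfl⟩ := three_dvd_of_not_unit k c hc
  have hdv : 9 ∣ 3 ^ k := pow_dvd_pow 3 hk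
  have h := congrArg (ZMod.castHom hdv (ZMod 9)) h00
  simp only [map_add, map_sub, map_mul, map_one, map_zero, map_ofNat] at h
  generalize ZMod.castHom hdv (ZMod 9) a = x at h
  generalize ZMod.castHom hdv (ZMod 9) b' = y at h
  generalize ZMod.castHom hdv (ZMod 9) c' = z at h
  revert x y z
  decide
end
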